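/- Let k(x) = e^{-c x} for some c > 0, and let W^x_taboo denote the law of the Brownian taboo process on (0,a) started at x ∈ [0,a]. Then there is a constant C depending only on c such that for all x ∈ [0,a] and all t ≥ 0: E^x_taboo[∫_0^t k(X_s) ds] ≤ C( t/a³ + min(1, 1/x) ). -/

import Mathlib

open Real MeasureTheory

/-- The transition density of the Brownian taboo process on `(0,a)` (Brownian motion
conditioned to stay in `(0,a)`, i.e. the Doob `h`-transform of Brownian motion killed at `0`
and `a` with respect to `h(x,t) = sin(πx/a) e^{π²t/(2a²)}`):
`p^taboo_t(x,y) = (sin(πy/a)/sin(πx/a)) e^{π²t/(2a²)} p^a_t(x,y)`, where `p^a_t` is the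
killed-Brownian-motion density given by its sine Fourier series. -/
noncomputable def tabooDensity (a t x y : ℝ) : ℝ :=
  (Real.sin (π * y / a) / Real.sin (π * x / a)) * Real.exp (π ^ 2 * t / (2 * a ^ 2)) *
    ((2 / a) * ∑' n : ℕ, Real.exp (-(π ^ 2 / (2 * a ^ 2)) * ((n : ℝ) + 1) ^ 2 * t) *
      Real.sin (π * ((n : ℝ) + 1) * x / a) * Real.sin (π * ((n : ℝ) + 1) * y / a))


lemma abel_bd (g u : ℕ → ℝ) (B : ℝ) (hg : ∀ n, g (n+1) ≤ g n) (h0 : ∀ n, 0 ≤ g n)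
    (hu : ∀ N, |∑ j ∈ Finset.range N, u j| ≤ B) (N : ℕ) :
    |∑ j ∈ Finset.range N, g j * u j| ≤ B * g 0 := by
  have key : ∀ N, |∑ j ∈ Finset.range N, g j * u j - g N * ∑ j ∈ Finset.range N, u j|
      ≤ B * (g 0 - g N) := by
    intro N
    induction N with
    | zero => simp
    | succ k ih =>
      have e : ∑ j ∈ Finset.range (k+1), g j * u j - g (k+1) * ∑ j ∈ Finset.range (k+1), u j
        = (∑ j ∈ Finset.range k, g j * u j - g k * ∑ j ∈ Finset.range k, u j)
          + (g k - g (k+1)) * ∑ j ∈ Finset.range (k+1), u j := by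
        simp only [Finset.sum_range_succ]; ring
      rw [e]
      refine (abs_add_le _ _).trans ?_
      rw [abs_mul, abs_of_nonneg (sub_nonneg.2 (hg k))]
      have := mul_le_mul_of_nonneg_left (hu (k+1)) (sub_nonneg.2 (hg k))
      linarith
  have h1 := key N
  have h2 : |g N * ∑ j ∈ Finset.range N, u j| ≤ g N * B := by
    rw [abs_mul, abs_of_nonneg (h0 N)]
    exact mul_le_mul_of_nonneg_left (hu N) (h0 N)
  have h3 := abs_add_le (∑ j ∈ Finset.range N, g j * u j - g N * ∑ j ∈ Finset.range N, u j)
    (g N * ∑ j ∈ Finset.range N, u j)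
  rw [sub_add_cancel] at h3
  linarith

noncomputable def tq (j : ℕ) : ℝ := ((j:ℝ)+2)/(((j:ℝ)+1)*((j:ℝ)+3))

lemma tq_nonneg (j : ℕ) : 0 ≤ tq j := by unfold tq; positivity

lemma tq_anti (j : ℕ) : tq (j+1) ≤ tq j := by
  unfold tq; push_cast
  rw [div_le_div_iff₀ (by positivity) (by positivity)]
  have : (0:ℝ) ≤ j := by positivity
  nlinarith [mul_nonneg this this, mul_nonneg this (mul_nonneg this this)]

lemma tq_mul (j : ℕ) : tq j * ((j:ℝ)+2) = 1 + 1/(((j:ℝ)+1)*((j:ℝ)+3)) := by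
  unfold tq; field_simp; ring

lemma tq_mul_le (j : ℕ) : tq j * ((j:ℝ)+2) ≤ 4/3 := by
  rw [tq_mul]
  have h : (0:ℝ) ≤ j := by positivity
  have : 1/(((j:ℝ)+1)*((j:ℝ)+3)) ≤ 1/3 := by
    apply one_div_le_one_div_of_le (by norm_num); nlinarith
  linarith

lemma tq_le (j : ℕ) : tq j ≤ 1/((j:ℝ)+1) := by
  unfold tq
  rw [div_le_div_iff₀ (by positivity) (by positivity)]
  have h : (0:ℝ) ≤ j := by positivity
  nlinarith

lemma sin_sum_bd (θ p : ℝ) (h0 : 0 < θ) (h1 : θ < π) (N : ℕ) :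
    |∑ i ∈ Finset.range N, Real.sin ((p + i) * θ)| ≤ π / θ := by
  have key : ∀ N : ℕ, 2 * Real.sin (θ/2) * ∑ i ∈ Finset.range N, Real.sin ((p + i) * θ)
      = Real.cos ((p - 1/2)*θ) - Real.cos ((p + N - 1/2)*θ) := by
    intro N
    induction N with
    | zero => simp
    | succ k ih =>
      rw [Finset.sum_range_succ, mul_add, ih]
      push_cast
      have e1 : (p + k - 1/2)*θ = (p+k)*θ - θ/2 := by ring
      have e2 : (p + (k+1) - 1/2)*θ = (p+k)*θ + θ/2 := by ring
      rw [e1, e2, Real.cos_sub, Real.cos_add]; ring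
  have hs : θ/π ≤ Real.sin (θ/2) := by
    have := Real.mul_le_sin (x := θ/2) (by linarith) (by linarith)
    calc θ/π = 2/π*(θ/2) := by ring
      _ ≤ _ := this
  have hpos : 0 < θ/π := by positivity
  have hk := key N
  have ha : |2 * Real.sin (θ/2) * ∑ i ∈ Finset.range N, Real.sin ((p + i) * θ)| ≤ 2 := by
    rw [hk]
    have a1 := abs_le.1 (Real.abs_cos_le_one ((p - 1/2)*θ))
    have a2 := abs_le.1 (Real.abs_cos_le_one ((p + N - 1/2)*θ))
    rw [abs_le]; constructor <;> linarith [a1.1, a1.2, a2.1, a2.2]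
  rw [abs_mul, abs_of_pos (by linarith : 0 < 2 * Real.sin (θ/2))] at ha
  set S := |∑ i ∈ Finset.range N, Real.sin ((p + i) * θ)|
  have hS : 0 ≤ S := abs_nonneg _
  have : θ/π * S ≤ 1 := by nlinarith
  rw [le_div_iff₀ h0]
  have h3 : θ / π * S = (S * θ)/π := by ring
  rw [h3, div_le_iff₀ pi_pos] at this
  linarith

lemma P1 (θ : ℝ) (h0 : 0 < θ) (h1 : θ < π) (N : ℕ) :
    |∑ j ∈ Finset.range N, tq j * Real.sin (((j:ℝ)+2)*θ)| ≤ 6 := by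
  set M := ⌊1/θ⌋₊ with hM
  have hMle : (M:ℝ) ≤ 1/θ := Nat.floor_le (by positivity)
  have hMlt : 1/θ < (M:ℝ) + 1 := Nat.lt_floor_add_one _
  have hpi := Real.pi_lt_d2
  have term : ∀ j : ℕ, |tq j * Real.sin (((j:ℝ)+2)*θ)| ≤ 4/3*θ := by
    intro j
    rw [abs_mul, abs_of_nonneg (tq_nonneg j)]
    have := Real.abs_sin_le_abs (x := ((j:ℝ)+2)*θ)
    rw [abs_of_nonneg (by positivity : 0 ≤ ((j:ℝ)+2)*θ)] at this
    calc _ ≤ tq j * (((j:ℝ)+2)*θ) := mul_le_mul_of_nonneg_left this (tq_nonneg j)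
      _ = tq j * ((j:ℝ)+2) * θ := by ring
      _ ≤ _ := mul_le_mul_of_nonneg_right (tq_mul_le j) h0.le
  have first : ∀ L : ℕ, L ≤ M → |∑ j ∈ Finset.range L, tq j * Real.sin (((j:ℝ)+2)*θ)| ≤ 4/3 := by
    intro L hL
    refine (Finset.abs_sum_le_sum_abs _ _).trans ((Finset.sum_le_sum fun j _ => term j).trans ?_)
    simp only [Finset.sum_const, Finset.card_range, nsmul_eq_mul]
    have : (L:ℝ) ≤ 1/θ := le_trans (by exact_mod_cast hL) hMle
    have h2 := mul_le_mul_of_nonneg_right this h0.le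
    rw [one_div_mul_cancel h0.ne'] at h2
    nlinarith
  rcases le_total N M with h | h
  · linarith [first N h]
  · obtain ⟨k, rfl⟩ := Nat.exists_eq_add_of_le h
    rw [Finset.sum_range_add]
    refine (abs_add_le _ _).trans ?_
    have t := abel_bd (fun i => tq (M+i)) (fun i => Real.sin ((((M:ℝ)+2) + i)*θ)) (π/θ)
      (fun n => tq_anti (M+n)) (fun n => tq_nonneg _) (fun N => sin_sum_bd θ _ h0 h1 N) k
    have e : ∑ i ∈ Finset.range k, tq (M+i) * Real.sin ((((M+i:ℕ):ℝ)+2)*θ)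
       = ∑ i ∈ Finset.range k, tq (M+i) * Real.sin ((((M:ℝ)+2) + i)*θ) := by
      refine Finset.sum_congr rfl fun i _ => ?_
      push_cast; ring_nf
    rw [e]
    have hq : tq (M+0) ≤ θ := by
      refine (tq_le _).trans ?_
      rw [add_zero, div_le_iff₀ (by positivity)]
      rw [div_lt_iff₀ h0] at hMlt
      linarith
    have : π/θ * tq (M+0) ≤ π := by
      calc _ ≤ π/θ*θ := mul_le_mul_of_nonneg_left hq (by positivity)
        _ = π := by field_simp
    have := first M le_rfl
    linarith

lemma altcos (φ : ℝ) (h0 : 0 ≤ φ) (h1 : φ ≤ π/2) (N : ℕ) :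
    |∑ j ∈ Finset.range N, (-1)^j * Real.cos (((j:ℝ)+2)*φ)| ≤ 2 := by
  have key : ∀ N : ℕ, 2 * Real.cos (φ/2) * ∑ j ∈ Finset.range N, (-1)^j * Real.cos (((j:ℝ)+2)*φ)
      = Real.cos ((3/2)*φ) - (-1)^N * Real.cos ((N + 3/2)*φ) := by
    intro N
    induction N with
    | zero => simp
    | succ k ih =>
      rw [Finset.sum_range_succ, mul_add, ih]
      push_cast
      have e1 : ((k:ℝ) + 3/2)*φ = (k+2)*φ - φ/2 := by ring
      have e2 : ((k:ℝ)+1 + 3/2)*φ = (k+2)*φ + φ/2 := by ring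
      rw [e1, e2, Real.cos_sub, Real.cos_add]; ring
  have hs : 1/2 ≤ Real.cos (φ/2) := by
    rw [← Real.cos_pi_div_three]
    apply Real.cos_le_cos_of_nonneg_of_le_pi <;> linarith [pi_pos]
  have ha : |2 * Real.cos (φ/2) * ∑ j ∈ Finset.range N, (-1)^j * Real.cos (((j:ℝ)+2)*φ)| ≤ 2 := by
    rw [key N]
    have a1 := Real.abs_cos_le_one ((3/2)*φ)
    have a2 := Real.abs_cos_le_one ((N + 3/2)*φ)
    refine (abs_sub _ _).trans ?_
    rw [abs_mul, abs_pow, abs_neg, abs_one, one_pow]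
    linarith
  rw [abs_mul, abs_of_pos (by linarith : 0 < 2 * Real.cos (φ/2))] at ha
  have := abs_nonneg (∑ j ∈ Finset.range N, (-1)^j * Real.cos (((j:ℝ)+2)*φ))
  nlinarith

lemma sumtel (N : ℕ) : ∑ j ∈ Finset.range N, 1/(((j:ℝ)+1)*((j:ℝ)+3)) ≤ 2 - 1/((N:ℝ)+1) := by
  induction N with
  | zero => simp
  | succ k ih =>
    rw [Finset.sum_range_succ]; push_cast
    have : 1/(((k:ℝ)+1)*((k:ℝ)+3)) ≤ 1/((k:ℝ)+1) - 1/((k:ℝ)+1+1) := by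
      have : 1/((k:ℝ)+1) - 1/((k:ℝ)+1+1) = 1/(((k:ℝ)+1)*((k:ℝ)+2)) := by field_simp; ring
      rw [this]
      apply one_div_le_one_div_of_le (by positivity)
      apply mul_le_mul_of_nonneg_left <;> linarith
    linarith

lemma P2 (φ : ℝ) (h0 : 0 ≤ φ) (h1 : φ ≤ π/2) (N : ℕ) :
    |∑ j ∈ Finset.range N, tq j * ((-1)^j * Real.sin (((j:ℝ)+2)*φ))| ≤ 4 * φ := by
  set f : ℝ → ℝ := fun φ => ∑ j ∈ Finset.range N, tq j * ((-1)^j * Real.sin (((j:ℝ)+2)*φ)) with hf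
  set f' : ℝ → ℝ := fun φ => ∑ j ∈ Finset.range N, tq j * ((-1)^j * (Real.cos (((j:ℝ)+2)*φ) * ((j:ℝ)+2)))
  have hd : ∀ y ∈ Set.Icc (0:ℝ) (π/2), HasDerivWithinAt f (f' y) (Set.Icc (0:ℝ) (π/2)) y := by
    intro y _
    apply HasDerivAt.hasDerivWithinAt
    apply HasDerivAt.fun_sum
    intro j _
    apply HasDerivAt.const_mul
    apply HasDerivAt.const_mul
    apply HasDerivAt.sin
    simpa using (hasDerivAt_id y).const_mul ((j:ℝ)+2)
  have hb : ∀ y ∈ Set.Icc (0:ℝ) (π/2), ‖f' y‖ ≤ 4 := by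
    intro y hy
    have e : f' y = ∑ j ∈ Finset.range N, (-1)^j * Real.cos (((j:ℝ)+2)*y)
      + ∑ j ∈ Finset.range N, 1/(((j:ℝ)+1)*((j:ℝ)+3)) * ((-1)^j * Real.cos (((j:ℝ)+2)*y)) := by
      rw [← Finset.sum_add_distrib]
      refine Finset.sum_congr rfl fun j _ => ?_
      calc _ = tq j * ((j:ℝ)+2) * ((-1)^j * Real.cos (((j:ℝ)+2)*y)) := by ring
        _ = _ := by rw [tq_mul]; ring
    rw [e, Real.norm_eq_abs]
    refine (abs_add_le _ _).trans ?_
    have a1 := altcos y hy.1 hy.2 N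
    have a2 : |∑ j ∈ Finset.range N, 1/(((j:ℝ)+1)*((j:ℝ)+3)) * ((-1)^j * Real.cos (((j:ℝ)+2)*y))| ≤ 2 := by
      refine (Finset.abs_sum_le_sum_abs _ _).trans ?_
      have : (0:ℝ) ≤ 1/((N:ℝ)+1) := by positivity
      refine (Finset.sum_le_sum fun j _ => ?_).trans ((sumtel N).trans (by linarith))
      rw [abs_mul, abs_mul, abs_pow, abs_neg, abs_one, one_pow, one_mul, abs_of_nonneg (by positivity)]
      exact mul_le_of_le_one_right (by positivity) (Real.abs_cos_le_one _)
    linarith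
  have := (convex_Icc (0:ℝ) (π/2)).norm_image_sub_le_of_norm_hasDerivWithin_le hd hb
    (Set.left_mem_Icc.2 (by positivity)) (Set.mem_Icc.2 ⟨h0, h1⟩)
  have f0 : f 0 = 0 := by simp [hf]
  rw [f0, sub_zero, sub_zero, Real.norm_eq_abs, Real.norm_eq_abs, abs_of_nonneg h0] at this
  exact this

noncomputable def tG (c b : ℝ) (j : ℕ) : ℝ :=
  1/((c^2+((j:ℝ)+1)^2*b^2)*(c^2+((j:ℝ)+3)^2*b^2))

lemma tG_nonneg (c b : ℝ) (j : ℕ) : 0 ≤ tG c b j := by unfold tG; positivity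

lemma tG_anti (c b : ℝ) (hc : 0 < c) (j : ℕ) : tG c b (j+1) ≤ tG c b j := by
  unfold tG
  apply one_div_le_one_div_of_le (by positivity)
  push_cast
  gcongr <;> linarith

lemma tG_zero (c b : ℝ) (hc : 0 < c) : tG c b 0 ≤ 1/c^4 := by
  unfold tG
  apply one_div_le_one_div_of_le (by positivity)
  have : 0 ≤ b^2 := by positivity
  have h2 : 0 ≤ c^2 := by positivity
  push_cast
  nlinarith [mul_nonneg this this, mul_nonneg this h2]

lemma P3 (c b : ℝ) (hc : 0 < c) (hb : 0 < b) (N : ℕ) :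
    ∑ j ∈ Finset.range N, tq j * ((j:ℝ)+2) * tG c b j ≤ 3/(c^3*b) := by
  have key : ∀ N : ℕ, ∑ j ∈ Finset.range N, 1/(c^2+((j:ℝ)+1)^2*b^2) ≤ 2/b*(1/c - 1/(c+N*b)) := by
    intro N
    induction N with
    | zero => simp
    | succ k ih =>
      rw [Finset.sum_range_succ]; push_cast
      have : 1/(c^2+((k:ℝ)+1)^2*b^2) ≤ 2/b*(1/(c+k*b) - 1/(c+(k+1)*b)) := by
        have : 2/b*(1/(c+k*b) - 1/(c+(k+1)*b)) = 2/((c+k*b)*(c+(k+1)*b)) := by field_simp; ring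
        rw [this, div_le_div_iff₀ (by positivity) (by positivity)]
        have hk : (0:ℝ) ≤ k := by positivity
        have h1 : (c+k*b)*(c+(k+1)*b) ≤ (c+(k+1)*b)*(c+(k+1)*b) := by
          apply mul_le_mul_of_nonneg_right _ (by positivity)
          nlinarith
        nlinarith [sq_nonneg (c-(k+1)*b)]
      nlinarith
  have h1 : ∀ j : ℕ, tq j * ((j:ℝ)+2) * tG c b j ≤ 4/3 * (1/c^2 * (1/(c^2+((j:ℝ)+1)^2*b^2))) := by
    intro j
    have : tG c b j ≤ 1/c^2 * (1/(c^2+((j:ℝ)+1)^2*b^2)) := by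
      unfold tG
      rw [one_div_mul_one_div]
      apply one_div_le_one_div_of_le (by positivity)
      rw [mul_comm]
      apply mul_le_mul_of_nonneg_left _ (by positivity)
      have : 0 ≤ ((j:ℝ)+3)^2*b^2 := by positivity
      linarith
    exact mul_le_mul (tq_mul_le j) this (tG_nonneg _ _ _) (by norm_num)
  refine (Finset.sum_le_sum fun j _ => h1 j).trans ?_
  rw [← Finset.mul_sum, ← Finset.mul_sum]
  have h2 : ∑ j ∈ Finset.range N, 1/(c^2+((j:ℝ)+1)^2*b^2) ≤ 2/b*(1/c) := by
    refine (key N).trans ?_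
    apply mul_le_mul_of_nonneg_left _ (by positivity)
    have : 0 ≤ 1/(c+N*b) := by positivity
    linarith
  calc _ ≤ 4/3*(1/c^2*(2/b*(1/c))) := by gcongr
    _ = (8/3)/(c^3*b) := by field_simp; ring
    _ ≤ _ := by gcongr; norm_num

lemma abel2 (c b B : ℝ) (hc : 0 < c) (e u : ℕ → ℝ) (he : ∀ n, e (n+1) ≤ e n)
    (he0 : ∀ n, 0 ≤ e n) (he1 : ∀ n, e n ≤ 1)
    (hu : ∀ N, |∑ j ∈ Finset.range N, u j| ≤ B) (N : ℕ) :
    |∑ j ∈ Finset.range N, tG c b j * (1 - e j) * u j| ≤ 2 * B / c^4 := by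
  have hB : 0 ≤ B := (abs_nonneg _).trans (hu 0)
  have h1 := abel_bd (tG c b) u B (tG_anti c b hc) (tG_nonneg c b) hu N
  have h2 := abel_bd (fun j => tG c b j * e j) u B
    (fun n => mul_le_mul (tG_anti c b hc n) (he n) (he0 _) (tG_nonneg c b n))
    (fun n => mul_nonneg (tG_nonneg c b n) (he0 n)) hu N
  have e1 : ∑ j ∈ Finset.range N, tG c b j * (1 - e j) * u j
     = ∑ j ∈ Finset.range N, tG c b j * u j - ∑ j ∈ Finset.range N, tG c b j * e j * u j := by
    rw [← Finset.sum_sub_distrib]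
    exact Finset.sum_congr rfl fun j _ => by ring
  rw [e1]
  refine (abs_sub _ _).trans ?_
  have h3 : B * tG c b 0 ≤ B * (1/c^4) := mul_le_mul_of_nonneg_left (tG_zero c b hc) hB
  have h4 : B * (tG c b 0 * e 0) ≤ B * tG c b 0 :=
    mul_le_mul_of_nonneg_left (mul_le_of_le_one_right (tG_nonneg c b 0) (he1 0)) hB
  have h5 : 2 * B / c^4 = B*(1/c^4) + B*(1/c^4) := by ring
  linarith

lemma abs_sin_nat_mul (n : ℕ) (x : ℝ) (hx : 0 ≤ Real.sin x) :
    |Real.sin ((n:ℝ) * x)| ≤ n * Real.sin x := by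
  induction n with
  | zero => simp
  | succ k ih =>
    push_cast
    rw [add_mul, one_mul, Real.sin_add]
    refine (abs_add_le _ _).trans ?_
    rw [abs_mul, abs_mul, abs_of_nonneg hx]
    have h1 := Real.abs_cos_le_one x
    have h2 := Real.abs_cos_le_one ((k:ℝ)*x)
    have h3 := abs_nonneg (Real.sin ((k:ℝ)*x))
    nlinarith

lemma Sabs (c b θ : ℝ) (hc : 0 < c) (hb : 0 < b) (hs : 0 ≤ Real.sin θ) (e v : ℕ → ℝ)
    (he0 : ∀ n, 0 ≤ e n) (he1 : ∀ n, e n ≤ 1) (hv : ∀ n, |v n| ≤ 1) (N : ℕ) :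
    |∑ j ∈ Finset.range N, tG c b j * (1 - e j) * (tq j * (v j * Real.sin (((j:ℝ)+2)*θ)))|
      ≤ 3/(c^3*b) * Real.sin θ := by
  refine (Finset.abs_sum_le_sum_abs _ _).trans ?_
  refine le_trans ?_ (mul_le_mul_of_nonneg_right (P3 c b hc hb N) hs)
  rw [Finset.sum_mul]
  refine Finset.sum_le_sum fun j _ => ?_
  rw [abs_mul, abs_mul, abs_mul, abs_mul, abs_of_nonneg (tG_nonneg c b j),
    abs_of_nonneg (tq_nonneg j), abs_of_nonneg (sub_nonneg.2 (he1 j))]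
  have h1 := abs_sin_nat_mul (j+2) θ hs
  push_cast at h1
  have h2 : tG c b j * (1 - e j) ≤ tG c b j :=
    mul_le_of_le_one_right (tG_nonneg c b j) (by linarith [he0 j])
  have h3 : |v j| * |Real.sin (((j:ℝ)+2)*θ)| ≤ ((j:ℝ)+2)*Real.sin θ :=
    (mul_le_of_le_one_left (abs_nonneg _) (hv j)).trans h1
  calc _ ≤ tG c b j * (tq j * (((j:ℝ)+2)*Real.sin θ)) :=
        mul_le_mul h2 (mul_le_mul_of_nonneg_left h3 (tq_nonneg j))
          (mul_nonneg (tq_nonneg j) (mul_nonneg (abs_nonneg _) (abs_nonneg _))) (tG_nonneg c b j)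
    _ = _ := by ring

lemma Rbd (c a x : ℝ) (hc : 0 < c) (ha : 0 < a) (hx0 : 0 < x) (hxa : x < a)
    (e : ℕ → ℝ) (he : ∀ n, e (n+1) ≤ e n)
    (he0 : ∀ n, 0 ≤ e n) (he1 : ∀ n, e n ≤ 1) (N : ℕ) :
    ∑ j ∈ Finset.range N, 8*c/a * ((1 + (-1)^j * Real.exp (-c*a)) *
      (tG c (π/a) j * (1 - e j) * (tq j * Real.sin (((j:ℝ)+2)*(π*x/a))))) / Real.sin (π*x/a)
      ≤ (16/c^2 + 136/c^3) * min 1 x⁻¹ := by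
  set θ := π*x/a with hθ
  set b := π/a with hb
  set E := Real.exp (-c*a) with hE
  have hbpos : 0 < b := by positivity
  have hθ0 : 0 < θ := by positivity
  have hθ1 : θ < π := by rw [hθ, div_lt_iff₀ ha]; nlinarith [pi_pos]
  have hs : 0 < Real.sin θ := Real.sin_pos_of_pos_of_lt_pi hθ0 hθ1
  have hE0 : 0 < E := Real.exp_pos _
  have hE1 : E ≤ 1 := by rw [hE]; apply Real.exp_le_one_iff.2; nlinarith
  have hEa : E * a ≤ 1/c := by
    have h := Real.add_one_le_exp (c*a)
    have h2 : E * Real.exp (c*a) = 1 := by rw [hE, ← Real.exp_add]; simp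
    rw [le_div_iff₀ hc]
    nlinarith
  set S1 := ∑ j ∈ Finset.range N, tG c b j * (1 - e j) * (tq j * Real.sin (((j:ℝ)+2)*θ)) with hS1
  set S2 := ∑ j ∈ Finset.range N, tG c b j * (1 - e j) * (tq j * ((-1)^j * Real.sin (((j:ℝ)+2)*θ))) with hS2
  have eR : ∑ j ∈ Finset.range N, 8*c/a * ((1 + (-1)^j * E) *
      (tG c b j * (1 - e j) * (tq j * Real.sin (((j:ℝ)+2)*θ)))) / Real.sin θ
      = 8*c/a/Real.sin θ * (S1 + E * S2) := by
    rw [hS1, hS2, Finset.mul_sum, ← Finset.sum_add_distrib, Finset.mul_sum]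
    exact Finset.sum_congr rfl fun j _ => by ring
  rw [eR]
  have hpm : ∀ n : ℕ, |(-1:ℝ)^n| ≤ 1 := fun n => by simp
  have A1 : |S1| ≤ 3/(c^3*b) * Real.sin θ := by
    have := Sabs c b θ hc hbpos hs.le e (fun _ => 1) he0 he1 (by simp) N
    simpa [one_mul] using this
  have A2 : |S2| ≤ 3/(c^3*b) * Real.sin θ := Sabs c b θ hc hbpos hs.le e (fun n => (-1)^n) he0 he1 hpm N
  have hb3 : 3/(c^3*b) ≤ a/c^3 := by
    rw [hb, div_le_div_iff₀ (by positivity) (by positivity)]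
    have e2 : a * (c^3*(π/a)) = π * c^3 := by field_simp
    rw [e2]
    exact mul_le_mul_of_nonneg_right pi_gt_three.le (by positivity)
  have A1' : S1 ≤ a/c^3 * Real.sin θ := (le_abs_self _).trans (A1.trans (by gcongr))
  have A2' : S2 ≤ a/c^3 * Real.sin θ := (le_abs_self _).trans (A2.trans (by gcongr))
  have hpre : 0 < 8*c/a/Real.sin θ := by positivity
  have hpi := Real.pi_lt_d2
  have B1 : 8*c/a/Real.sin θ * (S1 + E * S2) ≤ 16/c^2 := by
    have : S1 + E*S2 ≤ 2*(a/c^3*Real.sin θ) := by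
      have : E * S2 ≤ 1 * (a/c^3 * Real.sin θ) :=
        (mul_le_mul_of_nonneg_left A2' hE0.le).trans (mul_le_mul_of_nonneg_right hE1 (by positivity))
      linarith
    calc _ ≤ 8*c/a/Real.sin θ * (2*(a/c^3*Real.sin θ)) := mul_le_mul_of_nonneg_left this hpre.le
      _ = _ := by field_simp; ring
  have B2 : 8*c/a/Real.sin θ * (S1 + E * S2) ≤ 136/c^3 * x⁻¹ := by
    rcases le_total x (a/2) with hx | hx
    · have hθ2 : θ ≤ π/2 := by
        rw [hθ, div_le_iff₀ ha]; nlinarith [pi_pos]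
      have hsl : 2*x/a ≤ Real.sin θ := by
        have := Real.mul_le_sin hθ0.le hθ2
        calc 2*x/a = 2/π*θ := by rw [hθ]; field_simp
          _ ≤ _ := this
      have C1 : S1 ≤ 2*6/c^4 :=
        (le_abs_self _).trans (abel2 c b 6 hc e _ he he0 he1 (P1 θ hθ0 hθ1) N)
      have C2 : S2 ≤ 2*8/c^4 := by
        refine (le_abs_self _).trans (abel2 c b 8 hc e _ he he0 he1 (fun N => ?_) N)
        exact (P2 θ hθ0.le hθ2 N).trans (by linarith)
      have : S1 + E*S2 ≤ 28/c^4 := by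
        have h1 : E * S2 ≤ 1 * (2*8/c^4) :=
          (mul_le_mul_of_nonneg_left C2 hE0.le).trans (mul_le_mul_of_nonneg_right hE1 (by positivity))
        calc _ ≤ 2*6/c^4 + 1 * (2*8/c^4) := by linarith
          _ = _ := by ring
      calc _ ≤ 8*c/a/Real.sin θ * (28/c^4) := mul_le_mul_of_nonneg_left this hpre.le
        _ ≤ 8*c/a/(2*x/a) * (28/c^4) := by gcongr
        _ = 112/c^3 * x⁻¹ := by field_simp; ring
        _ ≤ _ := by gcongr; norm_num
    · set φ := π - θ with hφ
      have hφ0 : 0 < φ := by linarith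
      have hφ2 : φ ≤ π/2 := by
        have : π/2 ≤ θ := by rw [hθ, le_div_iff₀ ha]; nlinarith [pi_pos]
        linarith
      have hsφ : Real.sin θ = Real.sin φ := by rw [hφ, Real.sin_pi_sub]
      have hsl : φ ≤ 2*Real.sin θ := by
        have h := Real.mul_le_sin hφ0.le hφ2
        rw [hsφ]
        have : φ = π/2 * (2/π*φ) := by field_simp
        have h2 : π/2 * (2/π*φ) ≤ π/2 * Real.sin φ := mul_le_mul_of_nonneg_left h (by positivity)
        nlinarith [hsφ]
      have hflip : ∀ j : ℕ, Real.sin (((j:ℝ)+2)*θ) = -((-1)^j * Real.sin (((j:ℝ)+2)*φ)) := by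
        intro j
        have : ((j:ℝ)+2)*θ = ((j+2:ℕ):ℝ)*π - ((j:ℝ)+2)*φ := by rw [hφ]; push_cast; ring
        rw [this, Real.sin_sub, Real.sin_nat_mul_pi, Real.cos_nat_mul_pi, pow_add]; ring
      have C1 : S1 ≤ 2*(4*φ)/c^4 := by
        refine (le_abs_self _).trans (abel2 c b (4*φ) hc e _ he he0 he1 (fun N => ?_) N)
        have := P2 φ hφ0.le hφ2 N
        rw [← abs_neg, ← Finset.sum_neg_distrib]
        convert this using 3 with j _
        rw [hflip]; ring
      have h1 : E * S2 ≤ 1/c^4 * Real.sin θ := by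
        calc E * S2 ≤ E * (a/c^3 * Real.sin θ) := mul_le_mul_of_nonneg_left A2' hE0.le
          _ = (E*a) * (1/c^3*Real.sin θ) := by ring
          _ ≤ 1/c * (1/c^3*Real.sin θ) := by gcongr
          _ = _ := by field_simp
      have C1' : S1 ≤ 2*(4*(2*Real.sin θ))/c^4 := C1.trans (by gcongr)
      have : S1 + E*S2 ≤ 17/c^4*Real.sin θ := by
        calc _ ≤ 2*(4*(2*Real.sin θ))/c^4 + 1/c^4 * Real.sin θ := by linarith
          _ = _ := by ring
      calc _ ≤ 8*c/a/Real.sin θ * (17/c^4*Real.sin θ) := mul_le_mul_of_nonneg_left this hpre.le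
        _ = 136/c^3 * a⁻¹ := by field_simp; ring
        _ ≤ _ := by gcongr
  rcases le_total 1 x⁻¹ with h | h
  · rw [min_eq_left h]
    have : 0 ≤ 136/c^3 := by positivity
    linarith
  · rw [min_eq_right h]
    have : 0 ≤ 16/c^2*x⁻¹ := by positivity
    linarith

lemma intcos (c a : ℝ) (hc : 0 < c) (ha : 0 < a) (m : ℕ) :
    ∫ y in (0:ℝ)..a, Real.exp (-c*y) * Real.cos ((m:ℝ) * (π/a) * y)
      = c * (1 - (-1)^m * Real.exp (-c*a)) / (c^2 + (m:ℝ)^2*(π/a)^2) := by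
  set μ := (m:ℝ) * (π/a) with hμ
  have hd : c^2 + (m:ℝ)^2*(π/a)^2 = c^2 + μ^2 := by rw [hμ]; ring
  rw [hd]
  have hp : c^2 + μ^2 ≠ 0 := by positivity
  have hder : ∀ y ∈ Set.uIcc (0:ℝ) a, HasDerivAt
      (fun y => Real.exp (-c*y) * (-c * Real.cos (μ*y) + μ * Real.sin (μ*y)) / (c^2+μ^2))
      (Real.exp (-c*y) * Real.cos (μ*y)) y := by
    intro y _
    have h1 : HasDerivAt (fun y => -c*y) (-c) y := by
      simpa using (hasDerivAt_id y).const_mul (-c)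
    have h2 : HasDerivAt (fun y => μ*y) μ y := by
      simpa using (hasDerivAt_id y).const_mul μ
    have h := (h1.exp.mul ((h2.cos.const_mul (-c)).add (h2.sin.const_mul μ))).div_const (c^2+μ^2)
    refine h.congr_deriv ?_
    simp only [Pi.add_apply]
    field_simp
    ring
  rw [intervalIntegral.integral_eq_sub_of_hasDerivAt hder
    (Continuous.intervalIntegrable (by fun_prop) _ _)]
  have hma : μ * a = m * π := by rw [hμ]; field_simp
  rw [hma, Real.cos_nat_mul_pi, Real.sin_nat_mul_pi]
  simp
  field_simp
  ring

noncomputable def tK (c a : ℝ) (n : ℕ) : ℝ :=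
  (c/a) * (1 + (-1)^(n+1) * Real.exp (-c*a)) * (4 * ((n:ℝ)+1) * (π/a)^2 /
    ((c^2 + (n:ℝ)^2*(π/a)^2) * (c^2 + ((n:ℝ)+2)^2*(π/a)^2)))

lemma intK (c a : ℝ) (hc : 0 < c) (ha : 0 < a) (n : ℕ) :
    ∫ y in (0:ℝ)..a, (2/a) * (Real.exp (-c*y) * (Real.sin (π*y/a) * Real.sin (π*((n:ℝ)+1)*y/a)))
      = tK c a n := by
  have e : ∀ y : ℝ, (2/a) * (Real.exp (-c*y) * (Real.sin (π*y/a) * Real.sin (π*((n:ℝ)+1)*y/a)))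
     = (1/a) * (Real.exp (-c*y) * Real.cos ((n:ℝ) * (π/a) * y)
        - Real.exp (-c*y) * Real.cos (((n+2:ℕ):ℝ) * (π/a) * y)) := by
    intro y
    have e1 : (n:ℝ) * (π/a) * y = π*((n:ℝ)+1)*y/a - π*y/a := by ring
    have e2 : ((n+2:ℕ):ℝ) * (π/a) * y = π*((n:ℝ)+1)*y/a + π*y/a := by push_cast; ring
    rw [e1, e2, Real.cos_sub, Real.cos_add]; ring
  simp_rw [e]
  rw [intervalIntegral.integral_const_mul, intervalIntegral.integral_sub
    (Continuous.intervalIntegrable (by fun_prop) _ _)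
    (Continuous.intervalIntegrable (by fun_prop) _ _), intcos c a hc ha, intcos c a hc ha]
  unfold tK
  have hpi := pi_pos
  have h1 : c^2 + (n:ℝ)^2*(π/a)^2 ≠ 0 := by positivity
  have h2 : c^2 + ((n:ℝ)+2)^2*(π/a)^2 ≠ 0 := by positivity
  push_cast
  rw [pow_add, pow_add]
  generalize π/a = b at *
  field_simp
  ring

lemma tK_summable (c a : ℝ) (hc : 0 < c) (ha : 0 < a) : Summable (fun n => |tK c a n|) := by
  rw [← summable_nat_add_iff 1]
  have hs : Summable (fun j : ℕ => (c/a*2*(4/(π/a)^2)) * (1/((j:ℝ)+1)^2)) := by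
    apply Summable.mul_left
    have := (summable_nat_add_iff 1).2 (Real.summable_one_div_nat_pow.2 (by norm_num : 1 < 2))
    simpa using this
  refine Summable.of_nonneg_of_le (fun _ => abs_nonneg _) (fun j => ?_) hs
  have hpi := pi_pos
  have hE0 : 0 < Real.exp (-c*a) := Real.exp_pos _
  have hE1 : Real.exp (-c*a) ≤ 1 := by apply Real.exp_le_one_iff.2; nlinarith
  unfold tK
  have hb : 0 < π/a := by positivity
  generalize π/a = b at *
  have h1 : |1 + (-1)^(j+1+1) * Real.exp (-c*a)| ≤ 2 := by
    refine (abs_add_le _ _).trans ?_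
    rw [abs_mul, abs_pow, abs_neg, abs_one, one_pow, abs_of_pos hE0]; linarith
  push_cast
  rw [abs_mul, abs_mul, abs_of_pos (by positivity : 0 < c/a), mul_assoc (c/a*2)]
  refine mul_le_mul (mul_le_mul_of_nonneg_left h1 (by positivity)) ?_ (abs_nonneg _) (by positivity)
  rw [abs_of_nonneg (by positivity)]
  have e : 4/b^2*(1/((j:ℝ)+1)^2) = 4 * ((j:ℝ)+3)^2*b^2/((((j:ℝ)+1)^2*b^2)*(((j:ℝ)+3)^2*b^2)) := by
    field_simp
  rw [e]
  have hj : (0:ℝ) ≤ j := by positivity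
  apply div_le_div₀ (by positivity)
  · gcongr; nlinarith
  · positivity
  · apply mul_le_mul
    · nlinarith [sq_nonneg c]
    · have : (j:ℝ)+1+2 = j+3 := by ring
      rw [this]; nlinarith [sq_nonneg c]
    · positivity
    · positivity

noncomputable def tL (a : ℝ) (n : ℕ) : ℝ := (π/a)^2/2*(((n:ℝ)+1)^2-1)

noncomputable def tF (c a x : ℝ) (n : ℕ) (s : ℝ) : ℝ :=
  tK c a n * Real.exp (-(tL a n) * s) * (Real.sin (((n:ℝ)+1)*(π*x/a)) / Real.sin (π*x/a))

lemma inner_hasSum (c a x s : ℝ) (hc : 0 < c) (ha : 0 < a) (hs : 0 < s) :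
    ∫ y in (0 : ℝ)..a, Real.exp (-c * y) * tabooDensity a s x y = ∑' n, tF c a x n s := by
  set f : ℕ → C(ℝ, ℝ) := fun n => ⟨fun y => (Real.exp (-(tL a n) * s) *
    (Real.sin (((n:ℝ)+1)*(π*x/a)) / Real.sin (π*x/a))) *
    ((2/a) * (Real.exp (-c*y) * (Real.sin (π*y/a) * Real.sin (π*((n:ℝ)+1)*y/a)))), by fun_prop⟩ with hf
  have hsum : Summable fun n => ‖(f n).restrict (⟨Set.uIcc (0:ℝ) a, isCompact_uIcc⟩ : TopologicalSpace.Compacts ℝ)‖ := by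
    have hg : Summable (fun n : ℕ => Real.exp (-((π/a)^2/2*s) * n) * (1/|Real.sin (π*x/a)| * (2/a))) := by
      apply Summable.mul_right
      have : ∀ n : ℕ, Real.exp (-((π/a)^2/2*s) * n) = Real.exp (-((π/a)^2/2*s))^n := by
        intro n; rw [← Real.exp_nat_mul]; ring_nf
      simp_rw [this]
      apply summable_geometric_of_lt_one (Real.exp_pos _).le
      apply Real.exp_lt_one_iff.2
      have := pi_pos
      have : 0 < (π/a)^2/2*s := by positivity
      linarith
    refine Summable.of_nonneg_of_le (fun _ => norm_nonneg _) (fun n => ?_) hg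
    rw [ContinuousMap.norm_le _ (by positivity)]
    rintro ⟨y, hy⟩
    have hy' : y ∈ Set.uIcc (0:ℝ) a := hy
    rw [Set.uIcc_of_le ha.le] at hy'
    simp only [hf, ContinuousMap.restrict_apply, ContinuousMap.coe_mk, Real.norm_eq_abs]
    rw [abs_mul, abs_mul, abs_mul (2/a), abs_mul, abs_mul (Real.sin _), abs_div,
      abs_of_pos (Real.exp_pos _), abs_of_pos (Real.exp_pos _), abs_of_pos (by positivity : 0 < 2/a), mul_assoc]
    have h1 : Real.exp (-(tL a n) * s) ≤ Real.exp (-((π/a)^2/2*s) * n) := by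
      apply Real.exp_le_exp.2
      unfold tL
      have h : (n:ℝ) ≤ ((n:ℝ)+1)^2-1 := by
        have : (0:ℝ) ≤ n := by positivity
        nlinarith
      have h2 : 0 ≤ (π/a)^2/2*s := by positivity
      nlinarith [mul_le_mul_of_nonneg_left h h2]
    have h2 : Real.exp (-c*y) ≤ 1 := Real.exp_le_one_iff.2 (by nlinarith [hy'.1])
    have h3 := Real.abs_sin_le_one (((n:ℝ)+1)*(π*x/a))
    have h4 := Real.abs_sin_le_one (π*y/a)
    have h5 := Real.abs_sin_le_one (π*((n:ℝ)+1)*y/a)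
    have h6 : Real.exp (-c*y) * (|Real.sin (π*y/a)| * |Real.sin (π*((n:ℝ)+1)*y/a)|) ≤ 1 :=
      mul_le_one₀ h2 (by positivity) (mul_le_one₀ h4 (abs_nonneg _) h5)
    have h7 : 2/a * (Real.exp (-c*y) * (|Real.sin (π*y/a)| * |Real.sin (π*((n:ℝ)+1)*y/a)|)) ≤ 2/a :=
      mul_le_of_le_one_right (by positivity) h6
    refine mul_le_mul h1 (mul_le_mul ?_ h7 (by positivity) (by positivity)) (by positivity) (by positivity)
    gcongr
  have h := intervalIntegral.hasSum_intervalIntegral_of_summable_norm (a := (0:ℝ)) (b := a) (f := f) hsum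
  have e1 : ∀ n, ∫ y in (0:ℝ)..a, f n y = tF c a x n s := by
    intro n
    simp only [hf, ContinuousMap.coe_mk]
    rw [intervalIntegral.integral_const_mul, intK c a hc ha]
    unfold tF; ring
  simp_rw [e1] at h
  rw [h.tsum_eq]
  congr 1
  ext y
  unfold tabooDensity
  simp only [hf, ContinuousMap.coe_mk]
  rw [← tsum_mul_left, ← tsum_mul_left, ← tsum_mul_left]
  congr 1
  ext n
  have e2 : Real.exp (-(tL a n) * s) = Real.exp (π ^ 2 * s / (2 * a ^ 2)) *
      Real.exp (-(π ^ 2 / (2 * a ^ 2)) * ((n : ℝ) + 1) ^ 2 * s) := by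
    rw [← Real.exp_add]; congr 1; unfold tL; field_simp; ring
  have e3 : ((n:ℝ)+1)*(π*x/a) = π * ((n : ℝ) + 1) * x / a := by ring
  rw [e2, e3]; ring

lemma outer_hasSum (c a x t : ℝ) (hc : 0 < c) (ha : 0 < a) (ht : 0 ≤ t) :
    HasSum (fun n => ∫ s in (0:ℝ)..t, tF c a x n s)
    (∫ s in (0 : ℝ)..t, ∫ y in (0 : ℝ)..a, Real.exp (-c * y) * tabooDensity a s x y) := by
  have e0 : ∫ s in (0 : ℝ)..t, ∫ y in (0 : ℝ)..a, Real.exp (-c * y) * tabooDensity a s x y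
      = ∫ s in (0 : ℝ)..t, ∑' n, tF c a x n s := by
    apply intervalIntegral.integral_congr_ae
    filter_upwards with s hs
    rw [Set.uIoc_of_le ht] at hs
    exact inner_hasSum c a x s hc ha hs.1
  rw [e0]
  set f : ℕ → C(ℝ, ℝ) := fun n => ⟨fun s => tF c a x n s, by unfold tF; fun_prop⟩ with hf
  have hsum : Summable fun n => ‖(f n).restrict (⟨Set.uIcc (0:ℝ) t, isCompact_uIcc⟩ : TopologicalSpace.Compacts ℝ)‖ := by
    refine Summable.of_nonneg_of_le (fun _ => norm_nonneg _) (fun n => ?_)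
      ((tK_summable c a hc ha).mul_right (1/|Real.sin (π*x/a)|))
    rw [ContinuousMap.norm_le _ (by positivity)]
    rintro ⟨y, hy⟩
    have hy' : y ∈ Set.uIcc (0:ℝ) t := hy
    rw [Set.uIcc_of_le ht] at hy'
    simp only [hf, ContinuousMap.restrict_apply, ContinuousMap.coe_mk, Real.norm_eq_abs, tF]
    rw [abs_mul, abs_mul, abs_div, abs_of_pos (Real.exp_pos _)]
    have h3 := Real.abs_sin_le_one (((n:ℝ)+1)*(π*x/a))
    have h2 : Real.exp (-(tL a n)*y) ≤ 1 := by
      apply Real.exp_le_one_iff.2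
      have : 0 ≤ tL a n := by
        unfold tL
        have : (0:ℝ) ≤ n := by positivity
        have : 0 ≤ ((n:ℝ)+1)^2-1 := by nlinarith
        positivity
      nlinarith [mul_nonneg this hy'.1]
    refine mul_le_mul (mul_le_of_le_one_right (abs_nonneg _) h2) ?_ (by positivity) (abs_nonneg _)
    gcongr
  exact intervalIntegral.hasSum_intervalIntegral_of_summable_norm (a := (0:ℝ)) (b := t) (f := f) hsum

lemma tF_int (c a x t : ℝ) (hc : 0 < c) (ha : 0 < a) (j : ℕ) :
    ∫ s in (0:ℝ)..t, tF c a x (j+1) s = 8*c/a * ((1 + (-1)^j * Real.exp (-c*a)) *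
      (tG c (π/a) j * (1 - Real.exp (-(tL a (j+1))*t)) * (tq j * Real.sin (((j:ℝ)+2)*(π*x/a)))))
        / Real.sin (π*x/a) := by
  have hpi := pi_pos
  have hL : 0 < tL a (j+1) := by
    unfold tL; push_cast
    have : (0:ℝ) ≤ j := by positivity
    have : 0 < ((j:ℝ)+1+1)^2-1 := by nlinarith
    positivity
  have e : ∀ s, tF c a x (j+1) s = (tK c a (j+1) * (Real.sin (((j:ℝ)+2)*(π*x/a)) / Real.sin (π*x/a)))
      * Real.exp (-(tL a (j+1)) * s) := by
    intro s; unfold tF; push_cast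
    have : (j:ℝ)+1+1 = j+2 := by ring
    rw [this]; ring
  have hi : ∫ s in (0:ℝ)..t, Real.exp (-(tL a (j+1)) * s) = (1 - Real.exp (-(tL a (j+1))*t)) / tL a (j+1) := by
    rw [intervalIntegral.integral_eq_sub_of_hasDerivAt
      (f := fun s => -Real.exp (-(tL a (j+1)) * s) / tL a (j+1))]
    · simp; field_simp; ring
    · intro y _
      have h1 : HasDerivAt (fun y => -(tL a (j+1))*y) (-(tL a (j+1))) y := by
        simpa using (hasDerivAt_id y).const_mul (-(tL a (j+1)))
      refine (h1.exp.neg.div_const _).congr_deriv ?_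
      field_simp
    · exact Continuous.intervalIntegrable (by fun_prop) _ _
  simp_rw [e]
  rw [intervalIntegral.integral_const_mul, hi]
  have hKL : tK c a (j+1) / tL a (j+1) = 8*c/a * ((1 + (-1)^j * Real.exp (-c*a)) * (tG c (π/a) j * tq j)) := by
    rw [div_eq_iff hL.ne']
    unfold tK tL tG tq
    push_cast
    have h1 : c^2 + ((j:ℝ)+1)^2*(π/a)^2 ≠ 0 := by positivity
    have h2 : c^2 + ((j:ℝ)+3)^2*(π/a)^2 ≠ 0 := by positivity
    have h3 : (j:ℝ)+1+2 = j+3 := by ring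
    rw [h3, pow_succ, pow_succ]
    generalize π/a = b at *
    field_simp
    ring
  calc _ = tK c a (j+1) / tL a (j+1) * ((Real.sin (((j:ℝ)+2)*(π*x/a)) / Real.sin (π*x/a))
       * (1 - Real.exp (-(tL a (j+1))*t))) := by ring
    _ = _ := by rw [hKL]; ring

lemma tF_int0 (c a x t : ℝ) (hc : 0 < c) (ha : 0 < a) (hs : Real.sin (π*x/a) ≠ 0) (ht : 0 ≤ t) :
    ∫ s in (0:ℝ)..t, tF c a x 0 s ≤ 4*π^2/c^3 * (t/a^3) := by
  have e : ∀ s, tF c a x 0 s = tK c a 0 := by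
    intro s; unfold tF tL; simp; rw [div_self hs, mul_one]
  simp_rw [e]
  have hpi := pi_pos
  have hE0 : 0 < Real.exp (-c*a) := Real.exp_pos _
  have hK : tK c a 0 ≤ 4*π^2/c^3/a^3 := by
    unfold tK
    have h1 : 4 * (((0:ℕ):ℝ)+1) * (π/a)^2 / ((c^2 + ((0:ℕ):ℝ)^2*(π/a)^2) * (c^2 + (((0:ℕ):ℝ)+2)^2*(π/a)^2))
        ≤ 4*(π/a)^2/(c^2*c^2) := by
      push_cast
      have : 0 ≤ (π/a)^2 := by positivity
      apply div_le_div₀ (by positivity) (by linarith) (by positivity)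
      apply mul_le_mul <;> first | positivity | nlinarith
    calc _ ≤ (c/a) * 1 * (4*(π/a)^2/(c^2*c^2)) := by
          apply mul_le_mul _ h1 (by positivity) (by positivity)
          apply mul_le_mul_of_nonneg_left _ (by positivity)
          simp; positivity
      _ = _ := by field_simp
  rw [intervalIntegral.integral_const, sub_zero, smul_eq_mul]
  calc t * tK c a 0 ≤ t * (4*π^2/c^3/a^3) := mul_le_mul_of_nonneg_left hK ht
    _ = _ := by ring

/-- Let `k(x) = e^{-cx}` for some `c > 0`.  There is a constant `C` depending only on `c` such
that for all `a > 0`, all `x ∈ [0,a]` and all `t ≥ 0`, the expectation under the Brownian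
taboo process on `(0,a)` started at `x` satisfies
`E^x_taboo[∫_0^t k(X_s) ds] ≤ C (t/a³ + min(1, 1/x))` (with `min(1, 1/x) = 1` for `x = 0`). -/
theorem taboo_exp_integral_bound (c : ℝ) (hc : 0 < c) :
    ∃ C : ℝ, 0 < C ∧ ∀ a : ℝ, 0 < a → ∀ x ∈ Set.Icc (0 : ℝ) a, ∀ t : ℝ, 0 ≤ t →
      (∫ s in (0 : ℝ)..t, ∫ y in (0 : ℝ)..a, Real.exp (-c * y) * tabooDensity a s x y) ≤
        C * (t / a ^ 3 + (if x = 0 then 1 else min 1 x⁻¹)) := by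
  have hpi := pi_pos
  refine ⟨4*π^2/c^3 + (16/c^2 + 136/c^3), by positivity, ?_⟩
  rintro a ha x ⟨hx0, hxa⟩ t ht
  by_cases hs : Real.sin (π*x/a) = 0
  · have : ∀ s y, tabooDensity a s x y = 0 := by
      intro s y; unfold tabooDensity; rw [hs]; simp
    simp only [this, mul_zero, intervalIntegral.integral_zero]
    split_ifs <;> positivity
  have hx0' : 0 < x := by
    rcases hx0.lt_or_eq with h | h
    · exact h
    · exact absurd (by rw [← h]; simp) hs
  have hxa' : x < a := by
    rcases hxa.lt_or_eq with h | h
    · exact h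
    · exact absurd (by rw [h, mul_div_assoc, div_self ha.ne', mul_one, Real.sin_pi]) hs
  rw [if_neg hx0'.ne']
  have hsum := outer_hasSum c a x t hc ha ht
  have hmin : 0 ≤ min 1 x⁻¹ := by positivity
  have hA : 0 ≤ 4*π^2/c^3 := by positivity
  have hD : 0 ≤ 16/c^2 + 136/c^3 := by positivity
  have hT : 0 ≤ t/a^3 := by positivity
  have hmono : ∀ n, tL a (n+1) ≤ tL a (n+1+1) := by
    intro n; unfold tL; push_cast; gcongr; linarith
  have hL0 : ∀ n, 0 ≤ tL a n := by
    intro n; unfold tL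
    have : (0:ℝ) ≤ n := by positivity
    have : 0 ≤ ((n:ℝ)+1)^2-1 := by nlinarith
    positivity
  have hlim := (Filter.tendsto_add_atTop_iff_nat 1).2 hsum.tendsto_sum_nat
  refine le_of_tendsto' hlim fun N => ?_
  rw [Finset.sum_range_succ']
  have h0 := tF_int0 c a x t hc ha hs ht
  have h1 := Rbd c a x hc ha hx0' hxa' (fun j => Real.exp (-(tL a (j+1))*t))
    (fun n => Real.exp_le_exp.2 (by nlinarith [mul_le_mul_of_nonneg_right (hmono n) ht]))
    (fun n => (Real.exp_pos _).le)
    (fun n => Real.exp_le_one_iff.2 (by nlinarith [mul_nonneg (hL0 (n+1)) ht])) N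
  simp_rw [tF_int c a x t hc ha]
  nlinarith [mul_nonneg hA hmin, mul_nonneg hD hT]
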